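/- arXiv:2510.19530 — 4 statements merged into one kernel-verified Lean document; each statement's English description precedes it below -/
import Mathlib

section
/- Let T ≥ 1 be an integer, σ > 0, β ≥ 0, and set C₁ = 8 / Real.log(1 + σ⁻²). Let r_1, …, r_T and s_1, …, s_T be reals with 0 ≤ r_t, 0 ≤ s_t ≤ 1, and r_t ≤ 2·√β·√(s_t) for each t = 1, …, T, and let γ ≥ (1/2)·∑_{t=1}^T Real.log(1 + σ⁻²·s_t). Then ∑_{t=1}^T r_t ≤ √(C₁ · T · β · γ). -/
/-- The chord of the concave function `x ↦ log (1 + a * x)` on `[0, 1]` lies below its graph. -/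
theorem mul_log_one_add_le_log_one_add_mul {a x : ℝ} (ha : 0 ≤ a) (hx0 : 0 ≤ x) (hx1 : x ≤ 1) :
    x * Real.log (1 + a) ≤ Real.log (1 + a * x) := by
  have ha1 : 0 < 1 + a := by positivity
  rw [← Real.log_rpow ha1, mul_comm a x]
  exact Real.log_le_log (by positivity)
    (rpow_one_add_le_one_add_mul_self (by linarith) hx0 hx1)

/-- Deterministic regret bound (Lemma 4 / Theorem B.1): if `0 ≤ r t`,
`0 ≤ s t ≤ 1`, `r t ≤ 2·√β·√(s t)` for `t = 1, …, T`, and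
`γ ≥ (1/2)·∑_{t=1}^T log (1 + σ⁻²·s t)`, then with `C₁ = 8 / log (1 + σ⁻²)`,
`∑_{t=1}^T r t ≤ √(C₁·T·β·γ)`. -/
theorem regret_bound_finite_domain
    (T : ℕ) (hT : 1 ≤ T) (σ β : ℝ) (hσ : 0 < σ) (hβ : 0 ≤ β)
    (r s : ℕ → ℝ) (γ : ℝ)
    (hr : ∀ t ∈ Finset.Icc 1 T, 0 ≤ r t)
    (hs0 : ∀ t ∈ Finset.Icc 1 T, 0 ≤ s t)
    (hs1 : ∀ t ∈ Finset.Icc 1 T, s t ≤ 1)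
    (hrs : ∀ t ∈ Finset.Icc 1 T, r t ≤ 2 * Real.sqrt β * Real.sqrt (s t))
    (hγ : (1 / 2) * ∑ t ∈ Finset.Icc 1 T, Real.log (1 + σ⁻¹ ^ 2 * s t) ≤ γ) :
    ∑ t ∈ Finset.Icc 1 T, r t
      ≤ Real.sqrt ((8 / Real.log (1 + σ⁻¹ ^ 2)) * T * β * γ) := by
  have ha : 0 < σ⁻¹ ^ 2 := by positivity
  have hL : 0 < Real.log (1 + σ⁻¹ ^ 2) := Real.log_pos (by linarith)
  have hsum : ∑ t ∈ Finset.Icc 1 T, s t ≤ 2 * γ / Real.log (1 + σ⁻¹ ^ 2) := by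
    rw [le_div_iff₀ hL, Finset.sum_mul]
    have := Finset.sum_le_sum fun t ht =>
      mul_log_one_add_le_log_one_add_mul ha.le (hs0 t ht) (hs1 t ht)
    linarith
  have hsq : ∑ t ∈ Finset.Icc 1 T, r t ^ 2 ≤ 4 * β * ∑ t ∈ Finset.Icc 1 T, s t := by
    rw [Finset.mul_sum]
    refine Finset.sum_le_sum fun t ht => ?_
    calc r t ^ 2 ≤ (2 * Real.sqrt β * Real.sqrt (s t)) ^ 2 :=
          pow_le_pow_left₀ (hr t ht) (hrs t ht) 2
      _ = 4 * β * s t := by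
          rw [mul_pow, mul_pow, Real.sq_sqrt hβ, Real.sq_sqrt (hs0 t ht)]
          norm_num
  apply Real.le_sqrt_of_sq_le
  calc (∑ t ∈ Finset.Icc 1 T, r t) ^ 2 ≤ T * ∑ t ∈ Finset.Icc 1 T, r t ^ 2 := by
        simpa using sq_sum_le_card_mul_sum_sq (s := Finset.Icc 1 T) (f := r)
    _ ≤ T * (4 * β * ∑ t ∈ Finset.Icc 1 T, s t) := by gcongr
    _ ≤ T * (4 * β * (2 * γ / Real.log (1 + σ⁻¹ ^ 2))) := by gcongr
    _ = 8 / Real.log (1 + σ⁻¹ ^ 2) * T * β * γ := by ring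
end

section
/- Let T ≥ 1 be an integer, σ > 0, and set C₁ = 8 / Real.log(1 + σ⁻²). Let β_1 ≤ β_2 ≤ … ≤ β_T be nonnegative reals, let r_1, …, r_T and s_1, …, s_T be reals with 0 ≤ r_t, 0 ≤ s_t ≤ 1, and r_t ≤ 2·√(β_t)·√(s_t) + 1/t² for each t = 1, …, T, and let γ ≥ (1/2)·∑_{t=1}^T Real.log(1 + σ⁻²·s_t). Then ∑_{t=1}^T r_t ≤ 2·√(C₁ · T · β_T · γ) + π²/6. -/
/-- A form of Bernoulli's inequality: `log (1 + x)` is concave in `x`, so it lies above its chords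
through the origin. -/
theorem mul_log_one_add_le_log_one_add_mul_s6 {x s : ℝ} (hx : 0 ≤ x) (hs0 : 0 ≤ s) (hs1 : s ≤ 1) :
    s * Real.log (1 + x) ≤ Real.log (1 + x * s) := by
  have hpos : 0 < 1 + x := by positivity
  rw [← Real.log_rpow hpos, mul_comm x s]
  exact Real.log_le_log (Real.rpow_pos_of_pos hpos s)
    (rpow_one_add_le_one_add_mul_self (by linarith) hs0 hs1)

theorem sum_sqrt_le_sqrt_card_mul_sum {ι : Type*} (S : Finset ι) {f : ι → ℝ}
    (hf : ∀ i ∈ S, 0 ≤ f i) :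
    ∑ i ∈ S, Real.sqrt (f i) ≤ Real.sqrt (S.card * ∑ i ∈ S, f i) := by
  refine Real.le_sqrt_of_sq_le (sq_sum_le_card_mul_sum_sq.trans_eq ?_)
  rw [Finset.sum_congr rfl fun i hi => Real.sq_sqrt (hf i hi)]

theorem sum_one_div_sq_le_pi_sq_div_six (S : Finset ℕ) :
    ∑ t ∈ S, 1 / (t : ℝ) ^ 2 ≤ Real.pi ^ 2 / 6 :=
  sum_le_hasSum S (fun t _ => by positivity) hasSum_zeta_two

/-- Deterministic regret bound in the continuous case (Lemma 8 / Theorem B.6):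
if `β` is nondecreasing and nonnegative on `{1, …, T}`, `0 ≤ r t`, `0 ≤ s t ≤ 1`,
`r t ≤ 2·√(β t)·√(s t) + 1/t²` for `t = 1, …, T`, and
`γ ≥ (1/2)·∑_{t=1}^T log (1 + σ⁻²·s t)`, then with `C₁ = 8 / log (1 + σ⁻²)`,
`∑_{t=1}^T r t ≤ 2·√(C₁·T·(β T)·γ) + π²/6`. -/
theorem regret_bound_continuous_domain
    (T : ℕ) (hT : 1 ≤ T) (σ : ℝ) (hσ : 0 < σ)
    (β r s : ℕ → ℝ) (γ : ℝ)
    (hβ0 : ∀ t ∈ Finset.Icc 1 T, 0 ≤ β t)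
    (hβmono : ∀ a ∈ Finset.Icc 1 T, ∀ b ∈ Finset.Icc 1 T, a ≤ b → β a ≤ β b)
    (hr : ∀ t ∈ Finset.Icc 1 T, 0 ≤ r t)
    (hs0 : ∀ t ∈ Finset.Icc 1 T, 0 ≤ s t)
    (hs1 : ∀ t ∈ Finset.Icc 1 T, s t ≤ 1)
    (hrs : ∀ t ∈ Finset.Icc 1 T,
      r t ≤ 2 * Real.sqrt (β t) * Real.sqrt (s t) + 1 / (t : ℝ) ^ 2)
    (hγ : (1 / 2) * ∑ t ∈ Finset.Icc 1 T, Real.log (1 + σ⁻¹ ^ 2 * s t) ≤ γ) :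
    ∑ t ∈ Finset.Icc 1 T, r t
      ≤ 2 * Real.sqrt ((8 / Real.log (1 + σ⁻¹ ^ 2)) * T * β T * γ)
        + Real.pi ^ 2 / 6 := by
  have hT' : T ∈ Finset.Icc 1 T := Finset.mem_Icc.2 ⟨hT, le_rfl⟩
  have hβT : 0 ≤ β T := hβ0 T hT'
  have hx : 0 < σ⁻¹ ^ 2 := by positivity
  set L := Real.log (1 + σ⁻¹ ^ 2)
  have hLpos : 0 < L := Real.log_pos (by linarith)
  have hsum : (∑ t ∈ Finset.Icc 1 T, s t) * L ≤ 2 * γ := by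
    have h : (∑ t ∈ Finset.Icc 1 T, s t) * L
        ≤ ∑ t ∈ Finset.Icc 1 T, Real.log (1 + σ⁻¹ ^ 2 * s t) := by
      rw [Finset.sum_mul]
      exact Finset.sum_le_sum fun t ht =>
        mul_log_one_add_le_log_one_add_mul_s6 hx.le (hs0 t ht) (hs1 t ht)
    linarith
  have hs_nonneg : 0 ≤ ∑ t ∈ Finset.Icc 1 T, s t := Finset.sum_nonneg hs0
  have hγ0 : 0 ≤ γ := by nlinarith [mul_nonneg hs_nonneg hLpos.le]
  have hs_le : ∑ t ∈ Finset.Icc 1 T, s t ≤ 8 / L * γ := by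
    rw [div_mul_eq_mul_div, le_div_iff₀ hLpos]
    linarith
  have hsqrt : Real.sqrt (β T) * ∑ t ∈ Finset.Icc 1 T, Real.sqrt (s t)
      ≤ Real.sqrt (8 / L * T * β T * γ) := by
    calc Real.sqrt (β T) * ∑ t ∈ Finset.Icc 1 T, Real.sqrt (s t)
        ≤ Real.sqrt (β T) * Real.sqrt (T * ∑ t ∈ Finset.Icc 1 T, s t) := by
          gcongr
          simpa using sum_sqrt_le_sqrt_card_mul_sum (Finset.Icc 1 T) hs0
      _ = Real.sqrt (β T * (T * ∑ t ∈ Finset.Icc 1 T, s t)) := (Real.sqrt_mul hβT _).symm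
      _ ≤ Real.sqrt (β T * (T * (8 / L * γ))) := by gcongr
      _ = Real.sqrt (8 / L * T * β T * γ) := by ring_nf
  calc ∑ t ∈ Finset.Icc 1 T, r t
      ≤ ∑ t ∈ Finset.Icc 1 T,
          (2 * (Real.sqrt (β T) * Real.sqrt (s t)) + 1 / (t : ℝ) ^ 2) := by
        refine Finset.sum_le_sum fun t ht => (hrs t ht).trans ?_
        rw [mul_assoc]
        gcongr
        exact hβmono t ht T hT' (Finset.mem_Icc.1 ht).2
    _ = 2 * (Real.sqrt (β T) * ∑ t ∈ Finset.Icc 1 T, Real.sqrt (s t))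
          + ∑ t ∈ Finset.Icc 1 T, 1 / (t : ℝ) ^ 2 := by
        rw [Finset.sum_add_distrib, Finset.mul_sum, Finset.mul_sum]
    _ ≤ 2 * Real.sqrt (8 / L * T * β T * γ) + Real.pi ^ 2 / 6 := by
        gcongr
        exact sum_one_div_sq_le_pi_sq_div_six _
end

section
/- Let (α, ν) be a measure space with ν σ-finite and ν ≠ 0, let E : ℝ → α → ℝ be such that for each θ the map x ↦ Real.exp(−E θ x) is ν-integrable and ν-measurable, and let θ₀ ∈ ℝ. Assume there exist ε > 0 and a ν-integrable function g : α → ℝ such that for ν-almost every x, the map θ ↦ E θ x is differentiable on the ball of radius ε around θ₀ and |deriv (fun θ => E θ x) θ| · Real.exp(−E θ x) ≤ g x for all θ with |θ − θ₀| < ε. Set Z(θ) = ∫ x, Real.exp(−E θ x) ∂ν and p_{θ₀}(x) = Real.exp(−E θ₀ x) / Z(θ₀). Then HasDerivAt (fun θ => Real.log (Z θ)) (−∫ x, (deriv (fun θ => E θ x) θ₀) · p_{θ₀}(x) ∂ν) θ₀. -/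
open MeasureTheory

open Filter Topology in
/-- A pointwise a.e. derivative of a family of a.e. strongly measurable functions is
a.e. strongly measurable. -/
theorem aestronglyMeasurable_of_ae_hasDerivAt {α 𝕜 F : Type*} [MeasurableSpace α]
    {μ : Measure α} [NontriviallyNormedField 𝕜] [NormedAddCommGroup F] [NormedSpace 𝕜 F]
    {f : 𝕜 → α → F} {f' : α → F} {x₀ : 𝕜} (hf : ∀ x, AEStronglyMeasurable (f x) μ)
    (hf' : ∀ᵐ a ∂μ, HasDerivAt (fun x => f x a) (f' a) x₀) :
    AEStronglyMeasurable f' μ :=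
  aestronglyMeasurable_of_tendsto_ae (𝓝[≠] (0 : 𝕜))
    (f := fun t a => t⁻¹ • (f (x₀ + t) a - f x₀ a))
    (fun t => ((hf (x₀ + t)).sub (hf x₀)).const_smul t⁻¹)
    (hf'.mono fun _ ha => hasDerivAt_iff_tendsto_slope_zero.1 ha)

/-- Gradient of the log-partition function of an EBM:
`∇_θ log Z(θ₀) = -∫ (∂_θ E θ₀ x) · p_{θ₀}(x) dν`, where
`Z(θ) = ∫ exp (-E θ x) dν` and `p_{θ₀}(x) = exp (-E θ₀ x) / Z(θ₀)`. -/
theorem ebm_log_partition_hasDerivAt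
    {α : Type*} [MeasurableSpace α] (ν : Measure α) [SigmaFinite ν] (hν : ν ≠ 0)
    (E : ℝ → α → ℝ)
    (hint : ∀ θ, Integrable (fun x => Real.exp (-(E θ x))) ν)
    (hmeas : ∀ θ, Measurable (fun x => Real.exp (-(E θ x))))
    (θ₀ : ℝ)
    (hbound : ∃ ε > 0, ∃ g : α → ℝ, Integrable g ν ∧
      ∀ᵐ x ∂ν,
        (∀ θ ∈ Metric.ball θ₀ ε, DifferentiableAt ℝ (fun θ' => E θ' x) θ) ∧
        (∀ θ, |θ - θ₀| < ε →
          |deriv (fun θ' => E θ' x) θ| * Real.exp (-(E θ x)) ≤ g x)) :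
    HasDerivAt (fun θ => Real.log (∫ x, Real.exp (-(E θ x)) ∂ν))
      (-∫ x, deriv (fun θ' => E θ' x) θ₀ *
        (Real.exp (-(E θ₀ x)) / ∫ y, Real.exp (-(E θ₀ y)) ∂ν) ∂ν) θ₀ := by
  obtain ⟨ε, hε, g, hg, hE⟩ := hbound
  have : NeZero ν := ⟨hν⟩
  have hZ : 0 < ∫ x, Real.exp (-(E θ₀ x)) ∂ν := integral_exp_pos (hint θ₀)
  have hderiv : ∀ᵐ x ∂ν, ∀ θ ∈ Metric.ball θ₀ ε,
      HasDerivAt (fun θ' => Real.exp (-(E θ' x)))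
        (Real.exp (-(E θ x)) * -deriv (fun θ' => E θ' x) θ) θ :=
    hE.mono fun x hx θ hθ => (hx.1 θ hθ).hasDerivAt.fun_neg.exp
  have hZ' := (hasDerivAt_integral_of_dominated_loc_of_deriv_le
    (F := fun θ x => Real.exp (-(E θ x)))
    (F' := fun θ x => Real.exp (-(E θ x)) * -deriv (fun θ' => E θ' x) θ)
    (Metric.ball_mem_nhds θ₀ hε)
    (.of_forall fun θ => (hmeas θ).aestronglyMeasurable) (hint θ₀)
    (aestronglyMeasurable_of_ae_hasDerivAt (fun θ => (hmeas θ).aestronglyMeasurable)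
      (hderiv.mono fun x hx => hx θ₀ (Metric.mem_ball_self hε)))
    (hE.mono fun x hx θ hθ => by
      rw [norm_mul, norm_neg, Real.norm_eq_abs, Real.norm_eq_abs, Real.abs_exp, mul_comm]
      exact hx.2 θ (by rwa [Metric.mem_ball, Real.dist_eq] at hθ))
    hg hderiv).2
  convert hZ'.log hZ.ne' using 1
  rw [← integral_neg, ← integral_div]
  congr 1 with x
  ring
end

section
/- Let (α, ν) be a measure space with ν σ-finite and ν ≠ 0, let E : ℝ → α → ℝ satisfy, for each θ, that x ↦ Real.exp(−E θ x) is ν-integrable and ν-measurable, and let θ₀ ∈ ℝ. Assume there exist ε > 0 and a ν-integrable function g : α → ℝ such that for ν-almost every x, the map θ ↦ E θ x is differentiable on the ball of radius ε around θ₀ and |deriv (fun θ => E θ x) θ| · Real.exp(−E θ x) ≤ g x for all θ with |θ − θ₀| < ε. Set Z(θ) = ∫ x, Real.exp(−E θ x) ∂ν, p_θ(x) = Real.exp(−E θ x)/Z(θ), and for data points x_1, …, x_n ∈ α (n ≥ 1) such that θ ↦ E θ x_i is differentiable on the ball of radius ε around θ₀ for each i, let L(θ) = ∑_{i=1}^n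 Real.log (p_θ(x_i)). Then HasDerivAt (fun θ => (1/n) · L(θ)) (−(1/n)·∑_{i=1}^n (deriv (fun θ => E θ x_i) θ₀) + ∫ u, (deriv (fun θ => E θ u) θ₀) · p_{θ₀}(u) ∂ν) θ₀. -/
open MeasureTheory

/-- A pointwise a.e. derivative of a family of a.e. strongly measurable functions is a.e. strongly
measurable. -/
theorem aestronglyMeasurable_of_ae_hasDerivAt_s11 {α : Type*} [MeasurableSpace α] {μ : Measure α}
    {F : ℝ → α → ℝ} {F' : α → ℝ} {t : ℝ} (hF : ∀ s, AEStronglyMeasurable (F s) μ)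
    (h : ∀ᵐ a ∂μ, HasDerivAt (F · a) (F' a) t) : AEStronglyMeasurable F' μ := by
  refine aestronglyMeasurable_of_tendsto_ae (nhdsWithin (0 : ℝ) {0}ᶜ)
    (f := fun s a => s⁻¹ • (F (t + s) a - F t a))
    (fun s => ((hF (t + s)).sub (hF t)).const_smul s⁻¹) ?_
  filter_upwards [h] with a ha
  exact hasDerivAt_iff_tendsto_slope_zero.1 ha

/-- Positive-minus-negative decomposition of the EBM log-likelihood gradient:
with `Z(θ) = ∫ exp (-E θ x) dν`, `p_θ(x) = exp (-E θ x) / Z(θ)` and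
`L(θ) = ∑_{i=1}^n log p_θ(x_i)`, one has
`(1/n)·∇_θ L(θ₀) = -(1/n)·∑_i ∂_θ E θ₀ (x_i) + ∫ (∂_θ E θ₀ u) · p_{θ₀}(u) dν`. -/
theorem ebm_log_likelihood_gradient
    {α : Type*} [MeasurableSpace α] (ν : Measure α) [SigmaFinite ν] (hν : ν ≠ 0)
    (E : ℝ → α → ℝ)
    (hint : ∀ θ, Integrable (fun x => Real.exp (-(E θ x))) ν)
    (hmeas : ∀ θ, Measurable (fun x => Real.exp (-(E θ x))))
    (θ₀ : ℝ) (ε : ℝ) (hε : 0 < ε) (g : α → ℝ) (hg : Integrable g ν)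
    (hbound : ∀ᵐ x ∂ν,
        (∀ θ ∈ Metric.ball θ₀ ε, DifferentiableAt ℝ (fun θ' => E θ' x) θ) ∧
        (∀ θ, |θ - θ₀| < ε →
          |deriv (fun θ' => E θ' x) θ| * Real.exp (-(E θ x)) ≤ g x))
    (n : ℕ) (hn : 1 ≤ n) (x : Fin n → α)
    (hdiff : ∀ i : Fin n, ∀ θ ∈ Metric.ball θ₀ ε,
      DifferentiableAt ℝ (fun θ' => E θ' (x i)) θ) :
    HasDerivAt
      (fun θ => (1 / (n : ℝ)) *
        ∑ i, Real.log (Real.exp (-(E θ (x i))) / ∫ y, Real.exp (-(E θ y)) ∂ν))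
      (-(1 / (n : ℝ)) * ∑ i, deriv (fun θ' => E θ' (x i)) θ₀
        + ∫ u, deriv (fun θ' => E θ' u) θ₀ *
            (Real.exp (-(E θ₀ u)) / ∫ y, Real.exp (-(E θ₀ y)) ∂ν) ∂ν)
      θ₀ := by
  have hZ_pos : ∀ θ, 0 < ∫ y, Real.exp (-(E θ y)) ∂ν := by
    intro θ
    have : NeZero ν := ⟨hν⟩
    exact integral_exp_pos (hint θ)
  have hderiv : ∀ᵐ a ∂ν, ∀ θ ∈ Metric.ball θ₀ ε, HasDerivAt (fun θ' => Real.exp (-(E θ' a)))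
      (-(deriv (fun θ' => E θ' a) θ * Real.exp (-(E θ a)))) θ := by
    filter_upwards [hbound] with a ha θ hθ
    exact (ha.1 θ hθ).hasDerivAt.fun_neg.exp.congr_deriv (by ring)
  have hθ₀ : θ₀ ∈ Metric.ball θ₀ ε := Metric.mem_ball_self hε
  have hZ := (hasDerivAt_integral_of_dominated_loc_of_deriv_le
    (F' := fun θ a => -(deriv (fun θ' => E θ' a) θ * Real.exp (-(E θ a))))
    (Metric.ball_mem_nhds θ₀ hε)
    (.of_forall fun θ => (hint θ).aestronglyMeasurable) (hint θ₀)
    (aestronglyMeasurable_of_ae_hasDerivAt_s11 (fun θ => (hint θ).aestronglyMeasurable)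
      (hderiv.mono fun a ha => ha θ₀ hθ₀))
    (by
      filter_upwards [hbound] with a ha θ hθ
      rw [norm_neg, Real.norm_eq_abs, abs_mul, Real.abs_exp]
      exact ha.2 θ (by simpa [Real.dist_eq] using hθ))
    hg hderiv).2
  have hlog := hZ.log (hZ_pos θ₀).ne'
  have hlog_density : ∀ θ a, Real.log (Real.exp (-(E θ a)) / ∫ y, Real.exp (-(E θ y)) ∂ν) =
      -(E θ a) - Real.log (∫ y, Real.exp (-(E θ y)) ∂ν) := fun θ a => by
    rw [Real.log_div (Real.exp_pos _).ne' (hZ_pos θ).ne', Real.log_exp]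
  simp only [hlog_density]
  have hn0 : (n : ℝ) ≠ 0 := by positivity
  refine ((HasDerivAt.fun_sum fun i _ =>
    ((hdiff i θ₀ hθ₀).hasDerivAt.fun_neg.fun_sub hlog)).const_mul (1 / (n : ℝ))).congr_deriv ?_
  simp only [← mul_div_assoc, integral_div, integral_neg, Finset.sum_sub_distrib,
    Finset.sum_neg_distrib, Finset.sum_const, Finset.card_univ, Fintype.card_fin, nsmul_eq_mul]
  have := (hZ_pos θ₀).ne'
  field_simp
  ring
end
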